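/- Work on ℝ^5 with coordinates (x^1,x^2,u,u_1,u_2). Let T := √(1 + u_1² + u_2²), τ := 1 + u_1² + u_2², and V := 0. Let U, U_1, U_2, f^1, f^2 be infinitely differentiable (C^∞) functions on ℝ^5 satisfying: (16) ∂_{x^1}f^1 + ∂_{x^2}f^2 + Σ_{i,j} T^{ij} u_i U_j = 0; (17) ∂_u f^i − Σ_j T^{ij} U_j = 0 for i = 1,2; (18) ∂_{u_j} f^i + T^{ij} U = 0 for i,j = 1,2, where T^{ij} := ∂²T/∂u_i∂u_j. Then U is a constant function (all its partial derivatives vanish), and the functions A^i := f^i + U τ^{−1/2} u_i (i = 1,2) satisfy ∂_u A^i = 0, ∂_{u_1}A^i = ∂_{u_2}A^i = 0, and ∂_{x^1}A^1 + ∂_{x^2}A^2 = 0. -/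

import Mathlib

open scoped BigOperators

/-- The space `ℝ^5` with coordinates `(x^1, x^2, u, u_1, u_2)`. -/
abbrev Space5 := (Fin 2 → ℝ) × ℝ × (Fin 2 → ℝ)

/-- Partial derivative with respect to `x^i`. -/
noncomputable def pdxi (i : Fin 2) (f : Space5 → ℝ) (p : Space5) : ℝ :=
  fderiv ℝ f p (Pi.single i 1, (0 : ℝ), (0 : Fin 2 → ℝ))

/-- Partial derivative with respect to `u`. -/
noncomputable def pdu (f : Space5 → ℝ) (p : Space5) : ℝ :=
  fderiv ℝ f p ((0 : Fin 2 → ℝ), (1 : ℝ), (0 : Fin 2 → ℝ))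

/-- Partial derivative with respect to `u_j`. -/
noncomputable def pduj (j : Fin 2) (f : Space5 → ℝ) (p : Space5) : ℝ :=
  fderiv ℝ f p ((0 : Fin 2 → ℝ), (0 : ℝ), Pi.single j 1)

/-- The area Lagrangian `T(u_1,u_2) = √(1 + u_1² + u_2²)`. -/
noncomputable def Tms (v : Fin 2 → ℝ) : ℝ := Real.sqrt (1 + ∑ i, (v i) ^ 2)

/-- `τ = 1 + u_1² + u_2²`. -/
noncomputable def tau (v : Fin 2 → ℝ) : ℝ := 1 + ∑ i, (v i) ^ 2

/-- Hessian `T^{ij} = ∂²T/∂u_i∂u_j`. -/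
noncomputable def hessT (q : Fin 2 → ℝ) (i j : Fin 2) : ℝ :=
  fderiv ℝ (fun q' => fderiv ℝ Tms q' (Pi.single j 1)) q (Pi.single i 1)

open scoped ContDiff

lemma tau_pos (v : Fin 2 → ℝ) : 0 < tau v := by
  unfold tau
  positivity

lemma hasFDerivAt_tau (v : Fin 2 → ℝ) :
    HasFDerivAt tau (∑ i, (2 * v i) • ContinuousLinearMap.proj (R := ℝ) (φ := fun _ : Fin 2 => ℝ) i)
      v := by
  unfold tau
  refine HasFDerivAt.const_add _ (HasFDerivAt.fun_sum fun i _ => ?_)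
  simpa using (hasFDerivAt_apply (𝕜 := ℝ) i v).pow 2

lemma contDiff_tau : ContDiff ℝ ∞ tau := by
  unfold tau
  fun_prop

lemma fderiv_tau_single (v : Fin 2 → ℝ) (j : Fin 2) :
    fderiv ℝ tau v (Pi.single j 1) = 2 * v j := by
  rw [(hasFDerivAt_tau v).fderiv]
  fin_cases j <;> simp

/-- The gradient `∂T/∂u_i = τ^{-1/2} u_i` of the area Lagrangian. -/
noncomputable def gradT (i : Fin 2) (v : Fin 2 → ℝ) : ℝ := tau v ^ (-(1 / 2 : ℝ)) * v i

lemma fderiv_Tms_single (v : Fin 2 → ℝ) (j : Fin 2) :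
    fderiv ℝ Tms v (Pi.single j 1) = gradT j v := by
  have h := (hasFDerivAt_tau v).differentiableAt.hasFDerivAt.sqrt (tau_pos v).ne'
  have h' : HasFDerivAt Tms _ v := h
  rw [h'.fderiv]
  have hs : tau v ^ (-(1 / 2 : ℝ)) = (√(tau v))⁻¹ := by
    rw [Real.rpow_neg (tau_pos v).le, Real.sqrt_eq_rpow]
  simp only [smul_apply, fderiv_tau_single, smul_eq_mul, gradT, hs]
  have := (Real.sqrt_pos.2 (tau_pos v)).ne'
  field_simp

lemma contDiff_gradT (i : Fin 2) : ContDiff ℝ ∞ (gradT i) :=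
  (contDiff_tau.rpow_const_of_ne fun v => (tau_pos v).ne').mul (contDiff_apply ℝ ℝ i)

lemma hessT_eq_fderiv_gradT (v : Fin 2 → ℝ) (i j : Fin 2) :
    hessT v i j = fderiv ℝ (gradT j) v (Pi.single i 1) := by
  simp only [hessT, fderiv_Tms_single]

lemma hessT_eq (v : Fin 2 → ℝ) (i j : Fin 2) :
    hessT v i j = tau v ^ (-(1 / 2 : ℝ)) *
      ((if i = j then 1 else 0) - (tau v)⁻¹ * v i * v j) := by
  have h := ((hasFDerivAt_tau v).differentiableAt.hasFDerivAt.rpow_const (p := -(1 / 2 : ℝ))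
    (Or.inl (tau_pos v).ne')).mul (hasFDerivAt_apply (𝕜 := ℝ) j v)
  have h' : HasFDerivAt (gradT j) _ v := h
  rw [hessT_eq_fderiv_gradT, h'.fderiv]
  simp only [add_apply, smul_apply, fderiv_tau_single,
    smul_eq_mul, ContinuousLinearMap.proj_apply, Real.rpow_sub_one (tau_pos v).ne',
    Pi.single_apply, eq_comm (a := j)]
  ring

lemma hessT_symm (v : Fin 2 → ℝ) (i j : Fin 2) : hessT v i j = hessT v j i := by
  simp only [hessT_eq, eq_comm (a := i)]
  ring

/-- The Hessian of the area Lagrangian is invertible. -/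
lemma eq_zero_of_hessT_mul_eq {v a : Fin 2 → ℝ}
    (h : ∀ i j k, hessT v i k * a j = hessT v i j * a k) (j : Fin 2) : a j = 0 := by
  have h0 := h 0 0 1
  have h1 := h 1 0 1
  have hs : tau v ^ (-(1 / 2 : ℝ)) ≠ 0 := (Real.rpow_pos_of_pos (tau_pos v) _).ne'
  have ht := tau_pos v
  have hτ : tau v = 1 + (v 0 ^ 2 + v 1 ^ 2) := by simp [tau]
  simp only [hessT_eq, mul_assoc, mul_right_inj' hs] at h0 h1
  simp only [zero_ne_one, one_ne_zero, if_true, if_false] at h0 h1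
  field_simp at h0 h1
  have e0 : tau v * a 0 = 0 := by
    rw [hτ] at h0 h1 ⊢
    linear_combination v 0 * v 1 * h0 + (1 + v 1 ^ 2) * h1
  have e1 : tau v * a 1 = 0 := by
    rw [hτ] at h0 h1 ⊢
    linear_combination - (1 + v 0 ^ 2) * h0 - v 0 * v 1 * h1
  fin_cases j
  · exact (mul_eq_zero.1 e0).resolve_left ht.ne'
  · exact (mul_eq_zero.1 e1).resolve_left ht.ne'

lemma fderiv_fderiv_apply_comm {E : Type*} [NormedAddCommGroup E] [NormedSpace ℝ E]
    {F : E → ℝ} (hF : ContDiff ℝ ∞ F) (p v w : E) :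
    fderiv ℝ (fun q => fderiv ℝ F q v) p w = fderiv ℝ (fun q => fderiv ℝ F q w) p v := by
  have hd : DifferentiableAt ℝ (fderiv ℝ F) p :=
    ((hF.fderiv_right (m := 1) (by norm_cast)).differentiable one_ne_zero) p
  have hs : IsSymmSndFDerivAt ℝ F p :=
    hF.contDiffAt.isSymmSndFDerivAt (by
      rw [minSmoothness_of_isRCLikeNormedField]
      exact WithTop.coe_le_coe.2 (le_top : (2 : ℕ∞) ≤ ⊤))
  rw [fderiv_clm_apply hd (differentiableAt_const v), fderiv_clm_apply hd (differentiableAt_const w)]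
  simpa using hs w v

/-- The projection of `ℝ^5` to the coordinates `(x^1, x^2, u)`, viewed inside `ℝ^5`. -/
noncomputable def projBase : Space5 →L[ℝ] Space5 :=
  (ContinuousLinearMap.fst ℝ (Fin 2 → ℝ) (ℝ × (Fin 2 → ℝ))).prod
    (((ContinuousLinearMap.fst ℝ ℝ (Fin 2 → ℝ)).comp
      (ContinuousLinearMap.snd ℝ (Fin 2 → ℝ) (ℝ × (Fin 2 → ℝ)))).prod 0)

lemma fderiv_fiber {F : Space5 → ℝ} {p : Space5} (h : ∀ j, pduj j F p = 0) (w : Fin 2 → ℝ) :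
    fderiv ℝ F p (0, 0, w) = 0 := by
  have hw : ((0, 0, w) : Space5) = w 0 • ((0, 0, Pi.single 0 1) : Space5) +
      w 1 • ((0, 0, Pi.single 1 1) : Space5) := by
    ext i <;> simp
    fin_cases i <;> simp
  have h0 := h 0
  have h1 := h 1
  unfold pduj at h0 h1
  rw [hw, map_add, map_smul, map_smul, h0, h1]
  simp

lemma eq_comp_projBase {F : Space5 → ℝ} (hF : Differentiable ℝ F)
    (h : ∀ j p, pduj j F p = 0) : F = F ∘ projBase := by
  funext ⟨x, u, q⟩
  have hd : ∀ q, HasFDerivAt (fun q : Fin 2 → ℝ => F (x, u, q)) (0 : (Fin 2 → ℝ) →L[ℝ] ℝ) q := by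
    intro q
    have hg : HasFDerivAt (fun q : Fin 2 → ℝ => ((x, u, q) : Space5))
        (ContinuousLinearMap.prod 0 (ContinuousLinearMap.prod 0 (.id ℝ _))) q :=
      (hasFDerivAt_const x q).prodMk ((hasFDerivAt_const u q).prodMk (hasFDerivAt_id q))
    have hc := HasFDerivAt.comp (g := F) q (hF (x, u, q)).hasFDerivAt hg
    exact hc.congr_fderiv (ContinuousLinearMap.ext (fderiv_fiber fun j => h j _))
  exact is_const_of_fderiv_eq_zero (𝕜 := ℝ) (fun q => (hd q).differentiableAt)
    (fun q => (hd q).fderiv) q 0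

lemma fderiv_projBase {F : Space5 → ℝ} (hF : Differentiable ℝ F)
    (h : ∀ j p, pduj j F p = 0) (p v : Space5) :
    fderiv ℝ F p v = fderiv ℝ F (projBase p) (projBase v) := by
  have hc : HasFDerivAt (F ∘ projBase) _ p :=
    (hF (projBase p)).hasFDerivAt.comp p projBase.hasFDerivAt
  rw [← eq_comp_projBase hF h] at hc
  rw [hc.fderiv]
  rfl

lemma pdxi_projBase {F : Space5 → ℝ} (hF : Differentiable ℝ F)
    (h : ∀ j p, pduj j F p = 0) (i : Fin 2) (p : Space5) :
    pdxi i F p = pdxi i F (projBase p) :=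
  fderiv_projBase hF h p _

lemma pdu_projBase {F : Space5 → ℝ} (hF : Differentiable ℝ F)
    (h : ∀ j p, pduj j F p = 0) (p : Space5) :
    pdu F p = pdu F (projBase p) :=
  fderiv_projBase hF h p _

lemma fderiv_eq_zero_of_partials {F : Space5 → ℝ} {p : Space5} (hx : ∀ i, pdxi i F p = 0)
    (hu : pdu F p = 0) (hj : ∀ j, pduj j F p = 0) : fderiv ℝ F p = 0 := by
  refine ContinuousLinearMap.ext fun ⟨x, u, q⟩ => ?_
  have hv : ((x, u, q) : Space5) = x 0 • ((Pi.single 0 1, 0, 0) : Space5) +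
      x 1 • ((Pi.single 1 1, 0, 0) : Space5) + u • ((0, 1, 0) : Space5) + (0, 0, q) := by
    ext i <;> simp
    fin_cases i <;> simp
  have h0 := hx 0
  have h1 := hx 1
  unfold pdxi at h0 h1
  unfold pdu at hu
  rw [hv, map_add, map_add, map_add, map_smul, map_smul, map_smul, h0, h1, hu, fderiv_fiber hj]
  simp

lemma tau_rpow_single_of_sq {t s : ℝ} (hs : 0 < s) (h : 1 + t ^ 2 = (s ^ 2)⁻¹) (i : Fin 2) :
    tau (Pi.single i t) ^ (-(1 / 2 : ℝ)) = s := by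
  have ht : tau (Pi.single i t) = (s ^ 2)⁻¹ := by
    rw [← h]
    fin_cases i <;> simp [tau]
  rw [ht, Real.rpow_neg (by positivity), ← Real.sqrt_eq_rpow, Real.sqrt_inv, inv_inv,
    Real.sqrt_sq hs.le]

/-- The functions `1`, `τ^{-1/2} q_i`, `q_i` and `τ^{-1/2} |q|²` of `q` are linearly independent. -/
lemma coeffs_eq_zero {c w : ℝ} {a m : Fin 2 → ℝ}
    (h : ∀ q : Fin 2 → ℝ, c - ∑ i, m i * gradT i q + ∑ i, q i * (a i - w * gradT i q) = 0) :
    c = 0 ∧ w = 0 ∧ (∀ i, a i = 0) ∧ ∀ i, m i = 0 := by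
  have hc : c = 0 := by simpa [gradT] using h 0
  have key : ∀ (i : Fin 2) (t s : ℝ), 0 < s → 1 + t ^ 2 = (s ^ 2)⁻¹ →
      -(m i * (s * t)) + t * (a i - w * (s * t)) = 0 := by
    intro i t s hs hts
    have := h (Pi.single i t)
    simp only [gradT, tau_rpow_single_of_sq hs hts, hc] at this
    fin_cases i <;> simpa using this
  have h1 i := key i (3 / 4) (4 / 5) (by norm_num) (by norm_num)
  have h2 i := key i (-(3 / 4)) (4 / 5) (by norm_num) (by norm_num)
  have h3 i := key i (4 / 3) (3 / 5) (by norm_num) (by norm_num)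
  refine ⟨hc, by linarith [h1 0, h2 0], fun i => ?_, fun i => ?_⟩ <;>
    linarith [h1 i, h2 i, h3 i]

lemma fderiv_gradT_fiber (i : Fin 2) (p v : Space5) :
    fderiv ℝ (fun p : Space5 => gradT i p.2.2) p v = fderiv ℝ (gradT i) p.2.2 v.2.2 := by
  have hp : HasFDerivAt (fun p : Space5 => p.2.2) _ p :=
    ((ContinuousLinearMap.snd ℝ ℝ (Fin 2 → ℝ)).comp
      (ContinuousLinearMap.snd ℝ (Fin 2 → ℝ) (ℝ × (Fin 2 → ℝ)))).hasFDerivAt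
  have h := HasFDerivAt.comp (g := gradT i) p
    ((contDiff_gradT i).differentiable (by simp) p.2.2).hasFDerivAt hp
  exact congrArg (fun L : Space5 →L[ℝ] ℝ => L v) h.fderiv

lemma pduj_gradT (i j : Fin 2) (p : Space5) :
    pduj j (fun p : Space5 => gradT i p.2.2) p = hessT p.2.2 i j := by
  rw [hessT_symm, hessT_eq_fderiv_gradT, pduj, fderiv_gradT_fiber]

lemma fderiv_gradT_base (i : Fin 2) (p : Space5) (x : Fin 2 → ℝ) (u : ℝ) :
    fderiv ℝ (fun p : Space5 => gradT i p.2.2) p (x, u, 0) = 0 := by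
  rw [fderiv_gradT_fiber, map_zero]

/-- for the minimal-surface system (`n = 2`, `T = √(1+u_1²+u_2²)`,
`V = 0`), every PD-Noether symmetry/current pair is given by a constant `U`
and `f^i = −U τ^{−1/2} u_i + A^i` with `A^i` a divergence-free `x`-only pair. -/
theorem stmt_12
    (U : Space5 → ℝ) (Uj : Fin 2 → Space5 → ℝ) (f : Fin 2 → Space5 → ℝ)
    (hU : ContDiff ℝ (⊤ : ℕ∞) U) (hUj : ∀ j, ContDiff ℝ (⊤ : ℕ∞) (Uj j))
    (hf : ∀ i, ContDiff ℝ (⊤ : ℕ∞) (f i))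
    (h16 : ∀ p : Space5,
      (∑ i, pdxi i (f i) p) + (∑ i, ∑ j, hessT p.2.2 i j * p.2.2 i * Uj j p) = 0)
    (h17 : ∀ (i : Fin 2) (p : Space5),
      pdu (f i) p - (∑ j, hessT p.2.2 i j * Uj j p) = 0)
    (h18 : ∀ (i j : Fin 2) (p : Space5),
      pduj j (f i) p + hessT p.2.2 i j * U p = 0) :
    (∀ p : Space5, fderiv ℝ U p = 0) ∧
    (∀ (i : Fin 2) (p : Space5),
      pdu (fun p' => f i p' + U p' * (tau p'.2.2) ^ (-(1 / 2 : ℝ)) * p'.2.2 i) p = 0) ∧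
    (∀ (i j : Fin 2) (p : Space5),
      pduj j (fun p' => f i p' + U p' * (tau p'.2.2) ^ (-(1 / 2 : ℝ)) * p'.2.2 i) p = 0) ∧
    (∀ p : Space5,
      (∑ i, pdxi i (fun p' =>
        f i p' + U p' * (tau p'.2.2) ^ (-(1 / 2 : ℝ)) * p'.2.2 i) p) = 0) := by
  have hg : ∀ i, ContDiff ℝ ∞ (fun p : Space5 => gradT i p.2.2) := fun i =>
    (contDiff_gradT i).comp (by fun_prop)
  have hUd : Differentiable ℝ U := hU.differentiable (by simp)
  have hgT : ∀ i v, tau v ^ (-(1 / 2 : ℝ)) * v i = gradT i v := fun _ _ => rfl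
  simp only [mul_assoc, hgT]
  set A : Fin 2 → Space5 → ℝ := fun i p => f i p + U p * gradT i p.2.2
  have hAs : ∀ i, ContDiff ℝ ∞ (A i) := fun i => (hf i).add (hU.mul (hg i))
  have hAd : ∀ i, Differentiable ℝ (A i) := fun i => (hAs i).differentiable (by simp)
  have hprod : ∀ i p v, fderiv ℝ (A i) p v = fderiv ℝ (f i) p v +
      (U p * fderiv ℝ (fun p : Space5 => gradT i p.2.2) p v + gradT i p.2.2 * fderiv ℝ U p v) := by
    intro i p v
    have h : HasFDerivAt (A i) _ p := ((hf i).differentiable (by simp) p).hasFDerivAt.add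
      ((hUd p).hasFDerivAt.mul ((hg i).differentiable (by simp) p).hasFDerivAt)
    rw [h.fderiv]
    rfl
  have hAj : ∀ i j p, pduj j (A i) p = gradT i p.2.2 * pduj j U p := by
    intro i j p
    have h1 := hprod i p (0, 0, Pi.single j 1)
    have h2 := h18 i j p
    have h3 := pduj_gradT i j p
    simp only [pduj] at h2 h3 ⊢
    rw [h1, h3]
    linarith
  have hUj0 : ∀ j p, pduj j U p = 0 := by
    intro j p
    refine eq_zero_of_hessT_mul_eq (v := p.2.2) (a := fun j => pduj j U p) (fun i j k => ?_) j
    have hD : ∀ j k, pduj k (pduj j (A i)) p =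
        gradT i p.2.2 * pduj k (pduj j U) p + pduj j U p * hessT p.2.2 i k := by
      intro j k
      have hUjd : Differentiable ℝ (pduj j U) :=
        ((hU.fderiv_right (m := 1) (by norm_cast)).clm_apply contDiff_const).differentiable
          one_ne_zero
      have h : HasFDerivAt (fun p : Space5 => gradT i p.2.2 * pduj j U p) _ p :=
        ((hg i).differentiable (by simp) p).hasFDerivAt.mul (hUjd p).hasFDerivAt
      rw [← pduj_gradT i k p, show pduj j (A i) = _ from funext (hAj i j), pduj, h.fderiv]
      rfl
    have hs : pduj k (pduj j (A i)) p = pduj j (pduj k (A i)) p :=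
      fderiv_fderiv_apply_comm (hAs i) p _ _
    have hs' : pduj k (pduj j U) p = pduj j (pduj k U) p :=
      fderiv_fderiv_apply_comm hU p _ _
    rw [hD, hD, hs'] at hs
    linarith
  have hAj0 : ∀ i j p, pduj j (A i) p = 0 := fun i j p => by rw [hAj, hUj0, mul_zero]
  have hcoef : ∀ p, (∑ i, pdxi i (A i) p) = 0 ∧ pdu U p = 0 ∧ (∀ i, pdu (A i) p = 0) ∧
      ∀ i, pdxi i U p = 0 := by
    intro p
    refine coeffs_eq_zero (m := fun i => pdxi i U p)
      (a := fun i => pdu (A i) p) fun q => ?_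
    set r : Space5 := (p.1, p.2.1, q) with hr
    have hxA : ∀ i, pdxi i (A i) p = pdxi i (A i) r := fun i =>
      (pdxi_projBase (hAd i) (hAj0 i) i p).trans (pdxi_projBase (hAd i) (hAj0 i) i r).symm
    have huA : ∀ i, pdu (A i) p = pdu (A i) r := fun i =>
      (pdu_projBase (hAd i) (hAj0 i) p).trans (pdu_projBase (hAd i) (hAj0 i) r).symm
    have hxU : ∀ i, pdxi i U p = pdxi i U r := fun i =>
      (pdxi_projBase hUd hUj0 i p).trans (pdxi_projBase hUd hUj0 i r).symm
    have huU : pdu U p = pdu U r :=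
      (pdu_projBase hUd hUj0 p).trans (pdu_projBase hUd hUj0 r).symm
    have hx : ∀ i, pdxi i (A i) r = pdxi i (f i) r + gradT i q * pdxi i U r := by
      intro i
      simp only [pdxi, hprod, fderiv_gradT_base]
      simp [hr]
    have hu : ∀ i, pdu (A i) r = pdu (f i) r + gradT i q * pdu U r := by
      intro i
      simp only [pdu, hprod, fderiv_gradT_base]
      simp [hr]
    have e := h16 r
    have e0 := h17 0 r
    have e1 := h17 1 r
    simp only [hxA, huA, hxU, huU, hx, hu]
    simp only [Fin.sum_univ_two, show r.2.2 = q from rfl] at e e0 e1 ⊢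
    linear_combination e + q 0 * e0 + q 1 * e1
  exact ⟨fun p => fderiv_eq_zero_of_partials (hcoef p).2.2.2 (hcoef p).2.1 fun j => hUj0 j p,
    fun i p => (hcoef p).2.2.1 i, hAj0, fun p => (hcoef p).1⟩
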